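/- arXiv:2405.16240 — 5 statements merged into one kernel-verified Lean document; each statement's English description precedes it below -/
import Mathlib

section
/- (Absolute Aggregation law, two clients.) Let Xu be a real p×d matrix, Xv a real q×d matrix, Yu a real p×C matrix, Yv a real q×C matrix, and suppose Cu := XuᵀXu and Cv := XvᵀXv are both invertible; set Ru := Cu⁻¹, Rv := Cv⁻¹. Let X := [Xu; Xv] and Y := [Yu; Yv] be the row-stacked matrices, let Ŵ := (XᵀX)⁻¹·Xᵀ·Y, Ŵu := Ru·Xuᵀ·Yu, and Ŵv := Rv·Xvᵀ·Yv. Then Cu + Cv is invertible and Ŵ = 𝒲u·Ŵu + 𝒲v·Ŵv, where 𝒲u = I − Ru·Cv + Ru·Cv·(Cu+Cv)⁻¹·Cv and 𝒲v = I − Rv·Cu + Rv·Cu·(Cu+Cv)⁻¹·Cu. -/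
open Matrix

/-- The weight `1 - A⁻¹ * B + A⁻¹ * B * (A + B)⁻¹ * B` equals `(A + B)⁻¹ * A`. -/
theorem Matrix.one_sub_inv_mul_add_eq {n R : Type*} [Fintype n] [DecidableEq n] [CommRing R]
    {A B : Matrix n n R} (hA : IsUnit A) (hS : IsUnit (A + B)) :
    1 - A⁻¹ * B + A⁻¹ * B * (A + B)⁻¹ * B = (A + B)⁻¹ * A := by
  have hAdet := (isUnit_iff_isUnit_det A).mp hA
  have hSdet := (isUnit_iff_isUnit_det (A + B)).mp hS
  have inv_add : (A + B)⁻¹ = A⁻¹ - A⁻¹ * B * (A + B)⁻¹ := by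
    have h : A⁻¹ * (A + B) * (A + B)⁻¹ = (1 + A⁻¹ * B) * (A + B)⁻¹ := by
      rw [mul_add, nonsing_inv_mul A hAdet]
    rw [mul_nonsing_inv_cancel_right (A + B) A⁻¹ hSdet, add_mul, one_mul] at h
    exact eq_sub_of_add_eq h.symm
  calc 1 - A⁻¹ * B + A⁻¹ * B * (A + B)⁻¹ * B
      = 1 - (A⁻¹ - A⁻¹ * B * (A + B)⁻¹) * B := by noncomm_ring
    _ = (A + B)⁻¹ * (A + B) - (A + B)⁻¹ * B := by
      rw [← inv_add, nonsing_inv_mul (A + B) hSdet]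
    _ = (A + B)⁻¹ * A := by rw [← mul_sub, add_sub_cancel_right]

/-- The sum of an invertible real Gram matrix and any real Gram matrix is invertible. -/
theorem Matrix.isUnit_transpose_mul_self_add {m k n : Type*} [Fintype m] [Fintype k] [Fintype n]
    [DecidableEq n] {X : Matrix m n ℝ} {Z : Matrix k n ℝ} (hX : IsUnit (Xᵀ * X)) :
    IsUnit (Xᵀ * X + Zᵀ * Z) := by
  have hXpos : (Xᵀ * X).PosDef := by
    have h := posSemidef_conjTranspose_mul_self X
    rw [conjTranspose_eq_transpose_of_trivial] at h
    exact h.posDef_iff_isUnit.mpr hX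
  have hZ := posSemidef_conjTranspose_mul_self Z
  rw [conjTranspose_eq_transpose_of_trivial] at hZ
  exact (hXpos.add_posSemidef hZ).isUnit

/-- Absolute Aggregation law for two clients (Theorem 1): the least-squares
weight trained on the stacked data equals the matrix-weighted combination
`𝒲u·Ŵu + 𝒲v·Ŵv` of the two locally trained weights. -/
theorem absolute_aggregation_law {p q d C : ℕ}
    (Xu : Matrix (Fin p) (Fin d) ℝ) (Xv : Matrix (Fin q) (Fin d) ℝ)
    (Yu : Matrix (Fin p) (Fin C) ℝ) (Yv : Matrix (Fin q) (Fin C) ℝ)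
    (hu : IsUnit (Xuᵀ * Xu)) (hv : IsUnit (Xvᵀ * Xv)) :
    IsUnit (Xuᵀ * Xu + Xvᵀ * Xv) ∧
    ((fromRows Xu Xv)ᵀ * fromRows Xu Xv)⁻¹ * (fromRows Xu Xv)ᵀ * fromRows Yu Yv =
      (1 - (Xuᵀ * Xu)⁻¹ * (Xvᵀ * Xv)
         + (Xuᵀ * Xu)⁻¹ * (Xvᵀ * Xv) * (Xuᵀ * Xu + Xvᵀ * Xv)⁻¹ * (Xvᵀ * Xv)) *
        ((Xuᵀ * Xu)⁻¹ * Xuᵀ * Yu)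
      + (1 - (Xvᵀ * Xv)⁻¹ * (Xuᵀ * Xu)
         + (Xvᵀ * Xv)⁻¹ * (Xuᵀ * Xu) * (Xuᵀ * Xu + Xvᵀ * Xv)⁻¹ * (Xuᵀ * Xu)) *
        ((Xvᵀ * Xv)⁻¹ * Xvᵀ * Yv) := by
  have hS := isUnit_transpose_mul_self_add (Z := Xv) hu
  refine ⟨hS, ?_⟩
  have hS_comm : IsUnit (Xvᵀ * Xv + Xuᵀ * Xu) := add_comm (Xuᵀ * Xu) (Xvᵀ * Xv) ▸ hS
  have hWv := one_sub_inv_mul_add_eq hv hS_comm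
  rw [add_comm (Xvᵀ * Xv) (Xuᵀ * Xu)] at hWv
  rw [one_sub_inv_mul_add_eq hu hS, hWv, transpose_fromRows, fromCols_mul_fromRows,
    Matrix.mul_assoc _ (fromCols _ _), fromCols_mul_fromRows, Matrix.mul_add]
  simp only [Matrix.mul_assoc (_ : Matrix _ _ ℝ)⁻¹ _ (_ : Matrix _ (Fin C) ℝ),
    mul_nonsing_inv_cancel_left _ _ ((isUnit_iff_isUnit_det _).mp hu),
    mul_nonsing_inv_cancel_left _ _ ((isUnit_iff_isUnit_det _).mp hv)]
end

section
/- Let Xu be a real p×d matrix, Xv a real q×d matrix, Yu a real p×C matrix, Yv a real q×C matrix, and suppose Cu := XuᵀXu and Cv := XvᵀXv are both invertible. Let X := [Xu; Xv] and Y := [Yu; Yv] be the row-stacked matrices, Ŵu := Cu⁻¹·Xuᵀ·Yu and Ŵv := Cv⁻¹·Xvᵀ·Yv. Then Cu + Cv is invertible and the joint least-squares weight satisfies (XᵀX)⁻¹·Xᵀ·Y = (Cu+Cv)⁻¹·(Cu·Ŵu + Cv·Ŵv); i.e., the optimal aggregation of the two locally trained weights is their matrix-weighted linear combination with weights (Cu+Cv)⁻¹Cu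 and (Cu+Cv)⁻¹Cv. -/
open Matrix

/-- The joint least-squares weight is the matrix-weighted linear combination of
the two locally trained weights, with weights `(Cu+Cv)⁻¹Cu` and `(Cu+Cv)⁻¹Cv`. -/
theorem aggregation_as_weighted_combination {p q d C : ℕ}
    (Xu : Matrix (Fin p) (Fin d) ℝ) (Xv : Matrix (Fin q) (Fin d) ℝ)
    (Yu : Matrix (Fin p) (Fin C) ℝ) (Yv : Matrix (Fin q) (Fin C) ℝ)
    (hu : IsUnit (Xuᵀ * Xu)) (hv : IsUnit (Xvᵀ * Xv)) :
    IsUnit (Xuᵀ * Xu + Xvᵀ * Xv) ∧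
    ((fromRows Xu Xv)ᵀ * fromRows Xu Xv)⁻¹ * (fromRows Xu Xv)ᵀ * fromRows Yu Yv =
      (Xuᵀ * Xu + Xvᵀ * Xv)⁻¹ *
        ((Xuᵀ * Xu) * ((Xuᵀ * Xu)⁻¹ * Xuᵀ * Yu)
          + (Xvᵀ * Xv) * ((Xvᵀ * Xv)⁻¹ * Xvᵀ * Yv)) := by
  have psd {m : ℕ} (X : Matrix (Fin m) (Fin d) ℝ) : (Xᵀ * X).PosSemidef := by
    simpa using posSemidef_conjTranspose_mul_self X
  refine ⟨(((psd Xu).posDef_iff_isUnit.mpr hu).add_posSemidef (psd Xv)).isUnit, ?_⟩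
  rw [isUnit_iff_isUnit_det] at hu hv
  rw [transpose_fromRows, Matrix.mul_assoc, fromCols_mul_fromRows, fromCols_mul_fromRows,
    Matrix.mul_assoc _ Xuᵀ Yu, Matrix.mul_assoc _ Xvᵀ Yv,
    mul_nonsing_inv_cancel_left _ _ hu, mul_nonsing_inv_cancel_left _ _ hv]
end

section
/- (RI-AA law, two clients.) Let Xu be a real p×d matrix, Xv a real q×d matrix, Yu a real p×C matrix, Yv a real q×C matrix, γ > 0 a real number, Cu := XuᵀXu, Cv := XvᵀXv, Cuʳ := Cu + γ·I, Cvʳ := Cv + γ·I, Ruʳ := (Cuʳ)⁻¹, Rvʳ := (Cvʳ)⁻¹. Define the regularized local weights Ŵuʳ := Ruʳ·Xuᵀ·Yu and Ŵvʳ := Rvʳ·Xvᵀ·Yv, the aggregation weights 𝒲uʳ := I − Ruʳ·Cvʳ + Ruʳ·Cvʳ·(Cuʳ+Cvʳ)⁻¹·Cvʳ and 𝒲vʳ := I − Rvʳ·Cuʳ + Rvʳ·Cuʳ·(Cuʳ+Cvʳ)⁻¹·Cuʳ, and the regularized aggregate Ŵʳ := 𝒲uʳ·Ŵuʳ + 𝒲vʳ·Ŵvʳ.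 If Cu + Cv is invertible and Ŵ := (Cu+Cv)⁻¹·(Xuᵀ·Yu + Xvᵀ·Yv), then (Cuʳ + Cvʳ) and Cuʳ, Cvʳ are invertible and Ŵʳ = (Cu + Cv + 2γ·I)⁻¹·(Cu + Cv)·Ŵ. -/
open Matrix

/-- The Gram matrix of a real matrix becomes positive definite after adding a positive multiple
of the identity. -/
theorem posDef_transpose_mul_self_add_smul_one {m n : Type*} [Fintype m] [Fintype n]
    [DecidableEq n] (X : Matrix m n ℝ) {γ : ℝ} (hγ : 0 < γ) :
    (Xᵀ * X + γ • (1 : Matrix n n ℝ)).PosDef := by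
  have h : (Xᵀ * X).PosSemidef := by
    simpa using Matrix.posSemidef_conjTranspose_mul_self X
  exact Matrix.PosDef.posSemidef_add h (Matrix.PosDef.one.smul hγ)

/-- The aggregation weight built from `A` and `B` equals `(A + B)⁻¹ * A`; applied to `A⁻¹` it
gives `(A + B)⁻¹`. -/
theorem aggregation_weight_mul_inv {n : Type*} [Fintype n] [DecidableEq n]
    {A B : Matrix n n ℝ} (hA : IsUnit A) (hAB : IsUnit (A + B)) :
    (1 - A⁻¹ * B + A⁻¹ * B * (A + B)⁻¹ * B) * A⁻¹ = (A + B)⁻¹ := by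
  have h : A⁻¹ * B * (A + B)⁻¹ = A⁻¹ - (A + B)⁻¹ := by
    rw [Matrix.inv_sub_inv (iff_of_true hA hAB), add_sub_cancel_left]
  have hw : 1 - A⁻¹ * B + A⁻¹ * B * (A + B)⁻¹ * B = (A + B)⁻¹ * A := by
    rw [h, ← Matrix.nonsing_inv_mul (A + B) ((Matrix.isUnit_iff_isUnit_det _).mp hAB)]
    noncomm_ring
  rw [hw, Matrix.mul_assoc, Matrix.mul_nonsing_inv A ((Matrix.isUnit_iff_isUnit_det _).mp hA),
    Matrix.mul_one]

/-- RI-AA law for two clients (Theorem 2, two-client case): the regularized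
aggregate `Ŵʳ = 𝒲uʳ·Ŵuʳ + 𝒲vʳ·Ŵvʳ` relates to the unregularized joint weight
`Ŵ` via `Ŵʳ = (Cu + Cv + 2γI)⁻¹·(Cu + Cv)·Ŵ`. -/
theorem ri_aa_law_two_clients {p q d C : ℕ}
    (Xu : Matrix (Fin p) (Fin d) ℝ) (Xv : Matrix (Fin q) (Fin d) ℝ)
    (Yu : Matrix (Fin p) (Fin C) ℝ) (Yv : Matrix (Fin q) (Fin C) ℝ)
    (γ : ℝ) (hγ : 0 < γ)
    (hsum : IsUnit (Xuᵀ * Xu + Xvᵀ * Xv)) :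
    IsUnit ((Xuᵀ * Xu + γ • 1) + (Xvᵀ * Xv + γ • (1 : Matrix (Fin d) (Fin d) ℝ))) ∧
    IsUnit (Xuᵀ * Xu + γ • (1 : Matrix (Fin d) (Fin d) ℝ)) ∧
    IsUnit (Xvᵀ * Xv + γ • (1 : Matrix (Fin d) (Fin d) ℝ)) ∧
    (1 - (Xuᵀ * Xu + γ • 1)⁻¹ * (Xvᵀ * Xv + γ • 1)
       + (Xuᵀ * Xu + γ • 1)⁻¹ * (Xvᵀ * Xv + γ • 1) *
           ((Xuᵀ * Xu + γ • 1) + (Xvᵀ * Xv + γ • 1))⁻¹ * (Xvᵀ * Xv + γ • 1)) *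
        ((Xuᵀ * Xu + γ • 1)⁻¹ * Xuᵀ * Yu)
      + (1 - (Xvᵀ * Xv + γ • 1)⁻¹ * (Xuᵀ * Xu + γ • 1)
       + (Xvᵀ * Xv + γ • 1)⁻¹ * (Xuᵀ * Xu + γ • 1) *
           ((Xuᵀ * Xu + γ • 1) + (Xvᵀ * Xv + γ • 1))⁻¹ * (Xuᵀ * Xu + γ • 1)) *
        ((Xvᵀ * Xv + γ • 1)⁻¹ * Xvᵀ * Yv)
      = (Xuᵀ * Xu + Xvᵀ * Xv + (2 * γ) • 1)⁻¹ * (Xuᵀ * Xu + Xvᵀ * Xv) *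
          ((Xuᵀ * Xu + Xvᵀ * Xv)⁻¹ * (Xuᵀ * Yu + Xvᵀ * Yv)) := by
  have hu := posDef_transpose_mul_self_add_smul_one Xu hγ
  have hv := posDef_transpose_mul_self_add_smul_one Xv hγ
  have hS : Xuᵀ * Xu + Xvᵀ * Xv + (2 * γ) • (1 : Matrix (Fin d) (Fin d) ℝ) =
      (Xuᵀ * Xu + γ • 1) + (Xvᵀ * Xv + γ • 1) := by
    module
  refine ⟨(hu.add hv).isUnit, hu.isUnit, hv.isUnit, ?_⟩
  have hUV := (hu.add hv).isUnit
  rw [hS, Matrix.mul_assoc _ (Xuᵀ * Xu + Xvᵀ * Xv),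
    Matrix.mul_nonsing_inv_cancel_left _ _ ((Matrix.isUnit_iff_isUnit_det _).mp hsum)]
  generalize Xuᵀ * Xu + γ • 1 = A at hu hUV ⊢
  generalize Xvᵀ * Xv + γ • 1 = B at hv hUV ⊢
  have h₁ := aggregation_weight_mul_inv hu.isUnit hUV
  have h₂ := aggregation_weight_mul_inv hv.isUnit (add_comm A B ▸ hUV)
  rw [add_comm B A] at h₂
  rw [Matrix.mul_assoc A⁻¹ Xuᵀ, Matrix.mul_assoc B⁻¹ Xvᵀ, ← Matrix.mul_assoc _ A⁻¹,
    ← Matrix.mul_assoc _ B⁻¹, h₁, h₂, Matrix.mul_add]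
end

section
/- (Closed form of the unregularized pairwise aggregation recursion.) Let K ≥ 1, let X₁,…,X_K be real matrices with d columns and Y₁,…,Y_K real matrices with C columns, and suppose each C_i := X_iᵀX_i is invertible. Set C_agg,k := Σ_{i=1}^{k} C_i. Define the recursion: Ŵ_agg,1 := C₁⁻¹·X₁ᵀ·Y₁, and for 2 ≤ k ≤ K, Ŵ_agg,k := 𝒲_agg·Ŵ_agg,k−1 + 𝒲_k·Ŵ_k, where Ŵ_k := C_k⁻¹·X_kᵀ·Y_k, 𝒲_agg := I − (C_agg,k−1)⁻¹·C_k·(I − (C_agg,k)⁻¹·C_k) and 𝒲_k := I − C_k⁻¹·C_agg,k−1·(I − (C_agg,k)⁻¹·C_agg,k−1). Then for every 1 ≤ k ≤ K, the matrix C_agg,k is invertible and Ŵ_agg,k = (Σ_{i=1}^{k} C_i)⁻¹·(Σ_{i=1}^{k} X_iᵀ·Y_i); in particular the aggregate over all K clients equals the least-squares weight trained on the pooled dataset. -/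
open Matrix

namespace Matrix

/-- A Gram matrix that is invertible is positive definite. -/
theorem posDef_transpose_mul_self_of_isUnit {m n : Type*} [Fintype m] [Fintype n] [DecidableEq n]
    {A : Matrix m n ℝ} (hA : IsUnit (Aᵀ * A)) : (Aᵀ * A).PosDef := by
  rw [← conjTranspose_eq_transpose_of_trivial] at hA ⊢
  exact (posSemidef_conjTranspose_mul_self A).posDef_iff_isUnit.mpr hA

/-- The weight matrix of pairwise aggregation simplifies to `(A + B)⁻¹ * A`. -/
theorem one_sub_inv_mul_mul_one_sub_inv_add_mul {n R : Type*} [Fintype n] [DecidableEq n]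
    [CommRing R] {A B : Matrix n n R} (hA : IsUnit A) (hAB : IsUnit (A + B)) :
    1 - A⁻¹ * B * (1 - (A + B)⁻¹ * B) = (A + B)⁻¹ * A := by
  rw [isUnit_iff_isUnit_det] at hA hAB
  have h₁ : 1 - (A + B)⁻¹ * B = (A + B)⁻¹ * A := by
    rw [sub_eq_iff_eq_add, ← mul_add, nonsing_inv_mul _ hAB]
  have h₂ : B * ((A + B)⁻¹ * A) = A - A * ((A + B)⁻¹ * A) := by
    rw [eq_sub_iff_add_eq', ← add_mul, mul_nonsing_inv_cancel_left _ _ hAB]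
  rw [h₁, mul_assoc, h₂, mul_sub, nonsing_inv_mul _ hA, nonsing_inv_mul_cancel_left _ _ hA,
    sub_sub_cancel]

end Matrix

/-- Closed form of the unregularized pairwise aggregation recursion: when each
`Cᵢ = XᵢᵀXᵢ` is invertible, the accumulated aggregation weight after `k`
clients equals `(Σᵢ Cᵢ)⁻¹ · (Σᵢ Xᵢᵀ·Yᵢ)`; in particular, the aggregate over all
`K` clients is the least-squares weight trained on the pooled dataset.
Clients are indexed `1, …, K`. -/
theorem unregularized_aggregation_closed_form {d C K : ℕ} (hK : 1 ≤ K) {n : ℕ → ℕ}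
    (X : ∀ i : ℕ, Matrix (Fin (n i)) (Fin d) ℝ)
    (Y : ∀ i : ℕ, Matrix (Fin (n i)) (Fin C) ℝ)
    (hC : ∀ i : ℕ, 1 ≤ i → i ≤ K → IsUnit ((X i)ᵀ * X i))
    (W : ℕ → Matrix (Fin d) (Fin C) ℝ)
    (hW1 : W 1 = ((X 1)ᵀ * X 1)⁻¹ * (X 1)ᵀ * Y 1)
    (hWstep : ∀ k : ℕ, 2 ≤ k → k ≤ K →
      W k =
        (1 - (∑ i ∈ Finset.Icc 1 (k - 1), (X i)ᵀ * X i)⁻¹ * ((X k)ᵀ * X k) *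
              (1 - (∑ i ∈ Finset.Icc 1 k, (X i)ᵀ * X i)⁻¹ * ((X k)ᵀ * X k))) * W (k - 1)
        + (1 - ((X k)ᵀ * X k)⁻¹ * (∑ i ∈ Finset.Icc 1 (k - 1), (X i)ᵀ * X i) *
              (1 - (∑ i ∈ Finset.Icc 1 k, (X i)ᵀ * X i)⁻¹ *
                (∑ i ∈ Finset.Icc 1 (k - 1), (X i)ᵀ * X i))) *
            (((X k)ᵀ * X k)⁻¹ * (X k)ᵀ * Y k)) :
    ∀ k : ℕ, 1 ≤ k → k ≤ K →
      IsUnit (∑ i ∈ Finset.Icc 1 k, (X i)ᵀ * X i) ∧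
      W k = (∑ i ∈ Finset.Icc 1 k, (X i)ᵀ * X i)⁻¹ *
              (∑ i ∈ Finset.Icc 1 k, (X i)ᵀ * Y i) := by
  have hpos : ∀ k : ℕ, 1 ≤ k → k ≤ K → (∑ i ∈ Finset.Icc 1 k, (X i)ᵀ * X i).PosDef := by
    intro k hk
    induction k, hk using Nat.le_induction with
    | base =>
      intro h
      simpa using posDef_transpose_mul_self_of_isUnit (hC 1 le_rfl h)
    | succ k hk ih =>
      intro h
      rw [Finset.sum_Icc_succ_top (by lia)]
      exact (ih (by lia)).add (posDef_transpose_mul_self_of_isUnit (hC (k + 1) (by lia) h))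
  intro k hk hkK
  refine ⟨(hpos k hk hkK).isUnit, ?_⟩
  induction k, hk using Nat.le_induction with
  | base => simpa [Matrix.mul_assoc] using hW1
  | succ k hk ih =>
    have hA := (hpos k hk (by lia)).isUnit
    have hB := hC (k + 1) (by lia) hkK
    have hAB := (hpos (k + 1) (by lia) hkK).isUnit
    rw [Finset.sum_Icc_succ_top (by lia)] at hAB
    have hBA := hAB
    rw [add_comm] at hBA
    have hB' := one_sub_inv_mul_mul_one_sub_inv_add_mul hB hBA
    rw [add_comm ((X (k + 1))ᵀ * X (k + 1))] at hB'
    rw [hWstep (k + 1) (by lia) hkK, Nat.add_sub_cancel, Finset.sum_Icc_succ_top (by lia),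
      Finset.sum_Icc_succ_top (by lia), one_sub_inv_mul_mul_one_sub_inv_add_mul hA hAB, hB',
      ih (by lia), Matrix.mul_assoc _ _ (_⁻¹ * _), Matrix.mul_assoc _ _ (_⁻¹ * _ * _),
      Matrix.mul_assoc _⁻¹ _ (Y (k + 1)),
      mul_nonsing_inv_cancel_left _ _ ((isUnit_iff_isUnit_det _).mp hA),
      mul_nonsing_inv_cancel_left _ _ ((isUnit_iff_isUnit_det _).mp hB), ← Matrix.mul_add]
end

section
/- (Order invariance of aggregation.) Let K ≥ 1, let X₁,…,X_K be real matrices with d columns and Y₁,…,Y_K real matrices with C columns, suppose each C_i := X_iᵀX_i is invertible, and let σ be any permutation of {1,…,K}. Define the pairwise aggregation recursion in the order given by σ: W₍₁₎ := C_{σ(1)}⁻¹·X_{σ(1)}ᵀ·Y_{σ(1)}, and for 2 ≤ k ≤ K, W₍ₖ₎ := 𝒲_agg·W₍ₖ₋₁₎ + 𝒲·(C_{σ(k)}⁻¹·X_{σ(k)}ᵀ·Y_{σ(k)}), where with S_{k−1} := Σ_{j=1}^{k−1} C_{σ(j)} and S_k := S_{k−1} + C_{σ(k)} one sets 𝒲_agg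 := I − S_{k−1}⁻¹·C_{σ(k)}·(I − S_k⁻¹·C_{σ(k)}) and 𝒲 := I − C_{σ(k)}⁻¹·S_{k−1}·(I − S_k⁻¹·S_{k−1}). Then the final aggregate W₍K₎ equals (Σ_{i=1}^{K} C_i)⁻¹·(Σ_{i=1}^{K} X_iᵀ·Y_i), and in particular is the same for every permutation σ. -/
open Matrix

theorem Matrix.one_sub_inv_mul_mul_one_sub_inv_add_mul_s16 {m R : Type*} [Fintype m] [DecidableEq m]
    [CommRing R] {A B : Matrix m m R} (hA : IsUnit A) (hAB : IsUnit (A + B)) :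
    1 - A⁻¹ * B * (1 - (A + B)⁻¹ * B) = (A + B)⁻¹ * A := by
  have hA' := A.nonsing_inv_mul ((isUnit_iff_isUnit_det _).1 hA)
  have hT := (A + B).nonsing_inv_mul ((isUnit_iff_isUnit_det _).1 hAB)
  have hT' := (A + B).mul_nonsing_inv ((isUnit_iff_isUnit_det _).1 hAB)
  generalize (A + B)⁻¹ = T at *
  have h₁ : 1 - T * B = T * A := by rw [← hT]; noncomm_ring
  have h₂ : B * (T * A) = A * (1 - T * A) := by
    rw [mul_sub, mul_one, eq_sub_iff_add_eq]
    calc B * (T * A) + A * (T * A) = (A + B) * T * A := by noncomm_ring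
      _ = A := by rw [hT', one_mul]
  rw [h₁, mul_assoc, h₂, ← mul_assoc, hA', one_mul, sub_sub_cancel]

theorem Matrix.posDef_transpose_mul_self_of_isUnit_s16 {m p : Type*} [Fintype m] [Fintype p]
    [DecidableEq p] {X : Matrix m p ℝ} (hX : IsUnit (Xᵀ * X)) : (Xᵀ * X).PosDef := by
  have h := Matrix.posSemidef_conjTranspose_mul_self X
  rw [conjTranspose_eq_transpose_of_trivial] at h
  exact h.posDef_iff_isUnit.2 hX

theorem Fin.sum_filter_val_lt_succ {M : Type*} [AddCommMonoid M] {K k : ℕ} (h : k < K)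
    (f : Fin K → M) :
    ∑ j ∈ Finset.univ.filter (fun j : Fin K => (j : ℕ) < k + 1), f j =
      ∑ j ∈ Finset.univ.filter (fun j : Fin K => (j : ℕ) < k), f j + f ⟨k, h⟩ := by
  have : Finset.univ.filter (fun j : Fin K => (j : ℕ) < k + 1) =
      insert ⟨k, h⟩ (Finset.univ.filter (fun j : Fin K => (j : ℕ) < k)) := by
    ext j
    simp [Fin.ext_iff]
    omega
  rw [this, Finset.sum_insert (by simp), add_comm]

/-- Order invariance of aggregation: running the pairwise aggregation recursion
in the order given by any permutation `σ` of the clients `0, …, K−1` (0-based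
indexing; `W (k)` is the aggregate of the first `k` permuted clients) yields the
pooled least-squares weight `(Σᵢ Cᵢ)⁻¹·(Σᵢ XᵢᵀYᵢ)`, independently of `σ`. -/
theorem order_invariance_of_aggregation {d C K : ℕ} (hK : 0 < K) {n : Fin K → ℕ}
    (X : ∀ i : Fin K, Matrix (Fin (n i)) (Fin d) ℝ)
    (Y : ∀ i : Fin K, Matrix (Fin (n i)) (Fin C) ℝ)
    (hC : ∀ i : Fin K, IsUnit ((X i)ᵀ * X i))
    (σ : Equiv.Perm (Fin K))
    (W : ℕ → Matrix (Fin d) (Fin C) ℝ)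
    (hW1 : W 1 = ((X (σ ⟨0, hK⟩))ᵀ * X (σ ⟨0, hK⟩))⁻¹ * (X (σ ⟨0, hK⟩))ᵀ * Y (σ ⟨0, hK⟩))
    (hWstep : ∀ k : ℕ, ∀ h : k < K, 1 ≤ k →
      W (k + 1) =
        (1 - (∑ j ∈ Finset.univ.filter (fun j : Fin K => (j : ℕ) < k),
                (X (σ j))ᵀ * X (σ j))⁻¹ *
              ((X (σ ⟨k, h⟩))ᵀ * X (σ ⟨k, h⟩)) *
              (1 - (∑ j ∈ Finset.univ.filter (fun j : Fin K => (j : ℕ) < k + 1),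
                      (X (σ j))ᵀ * X (σ j))⁻¹ *
                ((X (σ ⟨k, h⟩))ᵀ * X (σ ⟨k, h⟩)))) * W k
        + (1 - ((X (σ ⟨k, h⟩))ᵀ * X (σ ⟨k, h⟩))⁻¹ *
              (∑ j ∈ Finset.univ.filter (fun j : Fin K => (j : ℕ) < k),
                (X (σ j))ᵀ * X (σ j)) *
              (1 - (∑ j ∈ Finset.univ.filter (fun j : Fin K => (j : ℕ) < k + 1),
                      (X (σ j))ᵀ * X (σ j))⁻¹ *
                (∑ j ∈ Finset.univ.filter (fun j : Fin K => (j : ℕ) < k),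
                  (X (σ j))ᵀ * X (σ j)))) *
            (((X (σ ⟨k, h⟩))ᵀ * X (σ ⟨k, h⟩))⁻¹ * (X (σ ⟨k, h⟩))ᵀ * Y (σ ⟨k, h⟩))) :
    W K = (∑ i, (X i)ᵀ * X i)⁻¹ * (∑ i, (X i)ᵀ * Y i) := by
  have hpos (k : ℕ) (hk : 1 ≤ k) :
      IsUnit (∑ j ∈ Finset.univ.filter (fun j : Fin K => (j : ℕ) < k),
        (X (σ j))ᵀ * X (σ j)) :=
    (Matrix.posDef_sum ⟨⟨0, hK⟩, by simp; omega⟩ fun j _ =>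
      Matrix.posDef_transpose_mul_self_of_isUnit_s16 (hC (σ j))).isUnit
  have key (k : ℕ) (hk : 1 ≤ k) : k ≤ K →
      W k = (∑ j ∈ Finset.univ.filter (fun j : Fin K => (j : ℕ) < k),
          (X (σ j))ᵀ * X (σ j))⁻¹ *
        ∑ j ∈ Finset.univ.filter (fun j : Fin K => (j : ℕ) < k), (X (σ j))ᵀ * Y (σ j) := by
    induction k, hk using Nat.le_induction with
    | base =>
      intro _
      rw [hW1, ← zero_add 1, Fin.sum_filter_val_lt_succ hK, Fin.sum_filter_val_lt_succ hK]
      simp [Matrix.mul_assoc]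
    | succ k hk ih =>
      intro h
      have hT := hpos (k + 1) (by omega)
      have hA := hpos k hk
      have hB := hC (σ ⟨k, h⟩)
      rw [hWstep k h hk, ih (by omega)]
      rw [Fin.sum_filter_val_lt_succ h] at hT
      simp only [Fin.sum_filter_val_lt_succ h]
      rw [Matrix.one_sub_inv_mul_mul_one_sub_inv_add_mul_s16 hA hT]
      rw [add_comm] at hT
      have hswap := Matrix.one_sub_inv_mul_mul_one_sub_inv_add_mul_s16 hB hT
      rw [add_comm ((X (σ ⟨k, h⟩))ᵀ * X (σ ⟨k, h⟩))] at hswap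
      rw [hswap, Matrix.mul_assoc _ _ (Y _), Matrix.mul_assoc (_⁻¹), Matrix.mul_assoc (_⁻¹),
        Matrix.mul_nonsing_inv_cancel_left _ _ ((Matrix.isUnit_iff_isUnit_det _).1 hA),
        Matrix.mul_nonsing_inv_cancel_left _ _ ((Matrix.isUnit_iff_isUnit_det _).1 hB),
        ← Matrix.mul_add]
  rw [key K hK le_rfl]
  simp only [Fin.is_lt, Finset.filter_true]
  rw [Equiv.sum_comp σ fun i => (X i)ᵀ * X i, Equiv.sum_comp σ fun i => (X i)ᵀ * Y i]
end
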